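/- Let f(x,y) be a binary cubic form with coefficients in ℤ₂ whose content is a unit (i.e., f is primitive). Then there exist x, y ∈ ℤ₂ with f(x,y) = 1 if and only if the reduction of f modulo 2 is not equal to the polynomial x·y·(x+y) over 𝔽₂. -/

import Mathlib

open Finset

/-- Evaluation of the binary form of degree `n` with coefficient vector `c` at `(x, y)`:
`c 0 * x^n + c 1 * x^(n-1) * y + ⋯ + c n * y^n`. -/
def binEval {n : ℕ} {R : Type*} [CommRing R] (c : Fin (n + 1) → R) (x y : R) : R :=
  ∑ i : Fin (n + 1), c i * x ^ (n - (i : ℕ)) * y ^ (i : ℕ)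

/-- The binary form with coefficient vector `c` as an element of `MvPolynomial (Fin 2) R`. -/
noncomputable def formPolyR {n : ℕ} {R : Type*} [CommRing R] (c : Fin (n + 1) → R) :
    MvPolynomial (Fin 2) R :=
  ∑ i : Fin (n + 1), MvPolynomial.C (c i) * MvPolynomial.X 0 ^ (n - (i : ℕ)) *
    MvPolynomial.X 1 ^ (i : ℕ)

/-- The binary form with integer coefficient vector `c`, base-changed to `R`. -/
noncomputable def formPoly {n : ℕ} (R : Type*) [CommRing R] (c : Fin (n + 1) → ℤ) :
    MvPolynomial (Fin 2) R :=
  formPolyR (fun i => ((c i : R)))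

/-- `F(X, 1)` over `R`, for the binary form with integer coefficient vector `c`. -/
noncomputable def formPolyX {n : ℕ} (R : Type*) [CommRing R] (c : Fin (n + 1) → ℤ) :
    Polynomial R :=
  ∑ i : Fin (n + 1), Polynomial.C ((c i : R)) * Polynomial.X ^ (n - (i : ℕ))

/-- `IsDisc c D`: the binary form with coefficient vector `c` factors over `ℂ` as
`∏ (αᵢ x - βᵢ y)` and `D = ∏_{i<j} (αᵢ βⱼ - αⱼ βᵢ)²` is its discriminant. -/
def IsDisc {n : ℕ} (c : Fin (n + 1) → ℤ) (D : ℤ) : Prop :=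
  ∃ α β : Fin n → ℂ,
    (∀ x y : ℂ, binEval (fun i => ((c i : ℂ))) x y = ∏ i : Fin n, (α i * x - β i * y)) ∧
    (D : ℂ) = ∏ i : Fin n, ∏ j ∈ Finset.univ.filter (fun j => i < j),
      (α i * β j - α j * β i) ^ 2

/-- `G` is a maximal form: it is not a proper subform of any integral binary form. -/
def IsMaximalForm {n : ℕ} (G : Fin (n + 1) → ℤ) : Prop :=
  ¬ ∃ (F : Fin (n + 1) → ℤ) (a b c d : ℤ), 1 < |a * d - b * c| ∧
      ∀ x y : ℤ, binEval G x y = binEval F (a * x + b * y) (c * x + d * y)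

/-- `GL₂(ℤ)`-equivalence of integral binary forms. -/
def FormEquiv {n : ℕ} (F G : Fin (n + 1) → ℤ) : Prop :=
  ∃ a b c d : ℤ, |a * d - b * c| = 1 ∧
    ∀ x y : ℤ, binEval G x y = binEval F (a * x + b * y) (c * x + d * y)

/-- The form locally represents `h` everywhere: over `ℝ` and over `ℤ_p` for all primes `p`. -/
def LocallyRep {n : ℕ} (c : Fin (n + 1) → ℤ) (h : ℤ) : Prop :=
  (∃ x y : ℝ, binEval (fun i => ((c i : ℝ))) x y = (h : ℝ)) ∧
  ∀ (p : ℕ) (hp : p.Prime),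
    haveI : Fact p.Prime := ⟨hp⟩
    ∃ x y : ℤ_[p], binEval (fun i => ((c i : ℤ_[p]))) x y = (h : ℤ_[p])

/-- The integral binary form is primitive: the gcd of its coefficients is 1. -/
def IsPrimitiveForm {n : ℕ} (c : Fin (n + 1) → ℤ) : Prop :=
  ∀ d : ℤ, (∀ i, d ∣ c i) → IsUnit d

/-- The form splits completely modulo `p`: modulo `p` it is a product of pairwise
non-proportional linear forms over `ℤ/pℤ`. -/
def SplitsCompletelyMod (p : ℕ) {n : ℕ} (c : Fin (n + 1) → ℤ) : Prop :=
  ∃ L : Fin n → ZMod p × ZMod p,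
    (∀ i j, i ≠ j → (L i).1 * (L j).2 ≠ (L j).1 * (L i).2) ∧
    formPoly (ZMod p) c =
      ∏ i : Fin n, (MvPolynomial.C (L i).1 * MvPolynomial.X 0 +
        MvPolynomial.C (L i).2 * MvPolynomial.X 1)

theorem PadicInt.toZMod_eq_zero_iff_dvd {p : ℕ} [Fact p.Prime] (z : ℤ_[p]) :
    PadicInt.toZMod z = 0 ↔ (p : ℤ_[p]) ∣ z := by
  rw [← RingHom.mem_ker, PadicInt.ker_toZMod, PadicInt.maximalIdeal_eq_span_p,
    Ideal.mem_span_singleton]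

/-- The inverse of an odd `2`-adic integer is a cube. -/
theorem exists_mul_pow_three_eq_one {u : ℤ_[2]} (hu : PadicInt.toZMod u = 1) :
    ∃ t : ℤ_[2], u * t ^ 3 = 1 := by
  have norm_lt_one : ‖u - 1‖ < 1 := by
    rw [PadicInt.norm_lt_one_iff_dvd, ← PadicInt.toZMod_eq_zero_iff_dvd, map_sub, hu, map_one,
      sub_self]
  have norm_eq_one : ‖3 * u‖ = 1 := by
    refine le_antisymm (PadicInt.norm_le_one _) (not_lt.mp fun h => ?_)
    rw [PadicInt.norm_lt_one_iff_dvd, ← PadicInt.toZMod_eq_zero_iff_dvd, map_mul, hu,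
      map_ofNat] at h
    exact absurd h (by decide)
  obtain ⟨t, ht, -⟩ := hensels_lemma
    (p := 2) (F := (Polynomial.C u * Polynomial.X ^ 3 - 1 : Polynomial ℤ_[2])) (a := 1)
    (by
      have derivative_norm : ‖u‖ * ‖(2 : ℤ_[2]) + 1‖ = 1 := by
        rw [← norm_mul, ← norm_eq_one]
        ring_nf
      simpa [derivative_norm] using norm_lt_one)
  exact ⟨t, by simpa [sub_eq_zero] using ht⟩

theorem binEval_mul_mul {n : ℕ} {R : Type*} [CommRing R] (c : Fin (n + 1) → R) (t x y : R) :
    binEval c (t * x) (t * y) = t ^ n * binEval c x y := by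
  simp only [binEval, Finset.mul_sum]
  refine Finset.sum_congr rfl fun i _ => ?_
  rw [← pow_sub_mul_pow t (Nat.le_of_lt_succ i.isLt)]
  ring

theorem map_binEval {n : ℕ} {R S : Type*} [CommRing R] [CommRing S] (φ : R →+* S)
    (c : Fin (n + 1) → R) (x y : R) :
    φ (binEval c x y) = binEval (fun i => φ (c i)) (φ x) (φ y) := by
  simp [binEval]

theorem exists_binEval_eq_one_of_toZMod {c : Fin 4 → ℤ_[2]} {x y : ℤ_[2]}
    (h : PadicInt.toZMod (binEval c x y) = 1) : ∃ x y : ℤ_[2], binEval c x y = 1 := by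
  obtain ⟨t, ht⟩ := exists_mul_pow_three_eq_one h
  exact ⟨t * x, t * y, by rw [binEval_mul_mul, mul_comm, ht]⟩

/-- A nonzero binary cubic form over `𝔽₂` vanishes at the three points of `ℙ¹(𝔽₂)` only if it is
`x y (x + y)`. -/
theorem eq_of_binEval_eq_zero_ZMod_two (a : Fin 4 → ZMod 2) (ha : ∃ i, a i ≠ 0)
    (h₁ : binEval a 1 0 = 0) (h₂ : binEval a 0 1 = 0) (h₃ : binEval a 1 1 = 0) :
    a 0 = 0 ∧ a 1 = 1 ∧ a 2 = 1 ∧ a 3 = 0 := by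
  revert a
  unfold binEval
  decide

/-- a primitive binary cubic form over `ℤ₂` represents `1` if and only if its
reduction modulo `2` is not the form `x y (x + y) = x²y + x y²`, i.e. its coefficient
vector mod 2 is not `(0, 1, 1, 0)`. -/
theorem represents_one_iff_Z2
    (c : Fin 4 → ℤ_[2]) (hprim : ∃ i, ¬ (2 : ℤ_[2]) ∣ c i) :
    (∃ x y : ℤ_[2], binEval c x y = 1) ↔
      ¬ (PadicInt.toZMod (c 0) = 0 ∧ PadicInt.toZMod (c 1) = 1 ∧
         PadicInt.toZMod (c 2) = 1 ∧ PadicInt.toZMod (c 3) = 0) := by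
  constructor
  · rintro ⟨x, y, hxy⟩ ⟨h₀, h₁, h₂, h₃⟩
    have h := congrArg PadicInt.toZMod hxy
    rw [map_binEval, map_one] at h
    have hc : (fun i => PadicInt.toZMod (c i)) = ![0, 1, 1, 0] := by
      funext i
      fin_cases i <;> assumption
    rw [hc] at h
    generalize PadicInt.toZMod x = a at h
    generalize PadicInt.toZMod y = b at h
    revert a b
    unfold binEval
    decide
  · intro h
    by_contra hrep
    have eval_eq_zero (x y : ℤ_[2]) :
        binEval (fun i => PadicInt.toZMod (c i)) (PadicInt.toZMod x) (PadicInt.toZMod y) = 0 := by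
      rw [← map_binEval]
      have h₁ : PadicInt.toZMod (binEval c x y) ≠ 1 :=
        fun h₁ => hrep (exists_binEval_eq_one_of_toZMod h₁)
      generalize PadicInt.toZMod (binEval c x y) = a at h₁ ⊢
      revert a
      decide
    refine h (eq_of_binEval_eq_zero_ZMod_two (fun i => PadicInt.toZMod (c i)) ?_ ?_ ?_ ?_)
    · exact hprim.imp fun i hi => mt (PadicInt.toZMod_eq_zero_iff_dvd (c i)).mp hi
    · simpa using eval_eq_zero 1 0
    · simpa using eval_eq_zero 0 1
    · simpa using eval_eq_zero 1 1
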